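/- Let X' be a nonempty set and let F be a class of functions f : ℕ × X' → [0,1] that are monotonically nondecreasing in the time coordinate: f(s,u) ≥ f(t,v) for every f ∈ F, every s > t, and every u, v ∈ X'. Fix β > 0 and let x be an (ℕ × X')-valued tree of depth d whose time coordinate strictly increases along every path (for every y ∈ {0,1}^d and t < d, the first coordinate of x_t(y) is strictly less than the first coordinate of x_{t+1}(y)). If x is β-shattered by F, then d ≤ 1/β. -/

import Mathlib

/-- A `Z`-valued tree of depth `d`, encoded as a function of the whole path, is predictable:
`z_t(y)` depends only on `y_1,…,y_{t−1}`. -/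
def Predictable {Z : Type*} (d : ℕ) (z : (Fin d → Bool) → Fin d → Z) : Prop :=
  ∀ y y' : Fin d → Bool, ∀ t : Fin d, (∀ s : Fin d, s < t → y s = y' s) → z y t = z y' t

/-- monotone experts. Let `F` be a class of `[0,1]`-valued functions on
`ℕ × X'` nondecreasing in the time coordinate, `β > 0`, and let `x` be an `(ℕ × X')`-valued
tree of depth `d` whose time coordinate strictly increases along every path. If `x` is
`β`-shattered by `F` (with witness tree `s`), then `d ≤ 1/β`. -/
theorem stmt10 {X' : Type*} [Nonempty X'] (F : Set (ℕ × X' → ℝ))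
    (hFval : ∀ f ∈ F, ∀ z, f z ∈ Set.Icc (0 : ℝ) 1)
    (hmono : ∀ f ∈ F, ∀ (s t : ℕ) (u v : X'), t < s → f (t, v) ≤ f (s, u))
    (β : ℝ) (hβ : 0 < β) (d : ℕ)
    (x : (Fin d → Bool) → Fin d → ℕ × X') (hx : Predictable d x)
    (hinc : ∀ (y : Fin d → Bool) (t : Fin d) (h : t.val + 1 < d),
      (x y t).1 < (x y ⟨t.val + 1, h⟩).1)
    (s : (Fin d → Bool) → Fin d → ℝ) (hs : Predictable d s)
    (hshat : ∀ y : Fin d → Bool, ∃ f ∈ F, ∀ t : Fin d,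
      (if y t then (1 : ℝ) else -1) * (f (x y t) - s y t) ≥ β / 2) :
    (d : ℝ) ≤ 1 / β := by
  rcases Nat.eq_zero_or_pos d with rfl | hd
  · simpa using hβ.le
  set ones : Fin d → Bool := fun _ => true with hones
  -- On the all-ones path the witness gains at least `β` at every step.
  have witness_lower : ∀ n (hn : n < d), β / 2 + n * β ≤ s ones ⟨n, hn⟩ := by
    intro n
    induction n with
    | zero =>
      intro hn
      obtain ⟨f, hf, hsh⟩ := hshat fun _ => false
      have h := hsh ⟨0, hn⟩
      have hs0 : s (fun _ => false) ⟨0, hn⟩ = s ones ⟨0, hn⟩ :=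
        hs _ _ _ fun r hr => absurd hr (Nat.not_lt_zero _)
      have h0 := (hFval f hf (x (fun _ => false) ⟨0, hn⟩)).1
      simp only [Bool.false_eq_true, if_false, hs0] at h
      push_cast
      linarith
    | succ n ih =>
      intro hn
      have hn' : n < d := Nat.lt_of_succ_lt hn
      set y : Fin d → Bool := fun r => decide (r.val ≤ n) with hy
      obtain ⟨f, hf, hsh⟩ := hshat y
      have agree : ∀ r : Fin d, r.val ≤ n → y r = ones r := fun r hr => by
        simp [hy, hones, hr]
      have hs1 : s y ⟨n, hn'⟩ = s ones ⟨n, hn'⟩ :=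
        hs _ _ _ fun r hr => agree r (Nat.le_of_lt hr)
      have hs2 : s y ⟨n + 1, hn⟩ = s ones ⟨n + 1, hn⟩ :=
        hs _ _ _ fun r hr => agree r (Nat.le_of_lt_succ hr)
      have h1 := hsh ⟨n, hn'⟩
      have h2 := hsh ⟨n + 1, hn⟩
      have hle : f (x y ⟨n, hn'⟩) ≤ f (x y ⟨n + 1, hn⟩) :=
        hmono f hf _ _ _ _ (hinc y ⟨n, hn'⟩ hn)
      have y1 : y ⟨n, hn'⟩ = true := by simp [hy]
      have y2 : y ⟨n + 1, hn⟩ = false := by simp [hy]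
      simp only [y1, if_true, hs1] at h1
      simp only [y2, Bool.false_eq_true, if_false, hs2] at h2
      have := ih hn'
      push_cast
      linarith
  obtain ⟨f, hf, hsh⟩ := hshat ones
  obtain ⟨m, rfl⟩ := Nat.exists_eq_succ_of_ne_zero hd.ne'
  have hlow := witness_lower m m.lt_succ_self
  have h := hsh ⟨m, m.lt_succ_self⟩
  have hup := (hFval f hf (x ones ⟨m, m.lt_succ_self⟩)).2
  have hlast : ones ⟨m, m.lt_succ_self⟩ = true := rfl
  simp only [hlast, if_true] at h
  rw [le_div_iff₀ hβ]
  push_cast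
  linarith
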